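/- Let C be a supercoalgebra and V a right C-supercomodule. The cotensor product functor V □_C − : (left C-supercomodules) → (super vector spaces), defined by the equalizer of ρ⊗id and id⊗λ, is left exact; and it is exact if and only if V is injective as a right C-supercomodule. -/

import Mathlib

/-!
STATEMENT 7: Let `C` be a supercoalgebra and `V` a right `C`-supercomodule.  The
cotensor product functor `V □_C −` on left `C`-supercomodules (defined as the equalizer
of `ρ ⊗ id` and `id ⊗ λ`) is left exact; and it is exact if and only if `V` is injective
as a right `C`-supercomodule.
-/

open TensorProduct

section Defs

variable {k : Type} [Field k] {C : Type} [AddCommGroup C] [Module k C]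

/-- `(Δ, ε)` is a coalgebra structure on `C`. -/
def IsCoalg (Δ : C →ₗ[k] C ⊗[k] C) (ε : C →ₗ[k] k) : Prop :=
  ((TensorProduct.assoc k C C C).toLinearMap ∘ₗ (LinearMap.rTensor C Δ) ∘ₗ Δ =
    (LinearMap.lTensor C Δ) ∘ₗ Δ) ∧
  ((TensorProduct.rid k C).toLinearMap ∘ₗ (LinearMap.lTensor C ε) ∘ₗ Δ = LinearMap.id) ∧
  ((TensorProduct.lid k C).toLinearMap ∘ₗ (LinearMap.rTensor C ε) ∘ₗ Δ = LinearMap.id)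

/-- Membership in the graded part of a tensor product of graded spaces. -/
def gradedTensorMem {V W : Type} [AddCommGroup V] [Module k V] [AddCommGroup W]
    [Module k W] (𝒱 : ZMod 2 → Submodule k V) (𝒲 : ZMod 2 → Submodule k W)
    (n : ZMod 2) (z : V ⊗[k] W) : Prop :=
  z ∈ ⨆ p : ZMod 2,
    LinearMap.range (TensorProduct.map (𝒱 p).subtype (𝒲 (n - p)).subtype)

/-- `ρ` is a right `C`-comodule structure on `V`. -/
def IsRightComod (Δ : C →ₗ[k] C ⊗[k] C) (ε : C →ₗ[k] k)
    {V : Type} [AddCommGroup V] [Module k V] (ρ : V →ₗ[k] V ⊗[k] C) : Prop :=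
  ((TensorProduct.assoc k V C C).toLinearMap ∘ₗ (LinearMap.rTensor C ρ) ∘ₗ ρ =
    (LinearMap.lTensor V Δ) ∘ₗ ρ) ∧
  ((TensorProduct.rid k V).toLinearMap ∘ₗ (LinearMap.lTensor V ε) ∘ₗ ρ = LinearMap.id)

/-- `lam` is a left `C`-comodule structure on `W`. -/
def IsLeftComod (Δ : C →ₗ[k] C ⊗[k] C) (ε : C →ₗ[k] k)
    {W : Type} [AddCommGroup W] [Module k W] (lam : W →ₗ[k] C ⊗[k] W) : Prop :=
  ((TensorProduct.assoc k C C W).symm.toLinearMap ∘ₗ (LinearMap.lTensor C lam) ∘ₗ lam =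
    (LinearMap.rTensor W Δ) ∘ₗ lam) ∧
  ((TensorProduct.lid k W).toLinearMap ∘ₗ (LinearMap.rTensor W ε) ∘ₗ lam = LinearMap.id)

variable (𝒞 : ZMod 2 → Submodule k C)

/-- The right comodule structure is graded (homogeneous of degree 0). -/
def RightComodGraded {V : Type} [AddCommGroup V] [Module k V]
    (𝒱 : ZMod 2 → Submodule k V) (ρ : V →ₗ[k] V ⊗[k] C) : Prop :=
  ∀ n : ZMod 2, ∀ v ∈ 𝒱 n, gradedTensorMem 𝒱 𝒞 n (ρ v)

/-- The left comodule structure is graded. -/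
def LeftComodGraded {W : Type} [AddCommGroup W] [Module k W]
    (𝒲 : ZMod 2 → Submodule k W) (lam : W →ₗ[k] C ⊗[k] W) : Prop :=
  ∀ n : ZMod 2, ∀ w ∈ 𝒲 n, gradedTensorMem 𝒞 𝒲 n (lam w)

/-- The cotensor product `V □_C W`, as the equalizer of `ρ ⊗ id` and `id ⊗ λ`. -/
noncomputable def cotensor {V W : Type} [AddCommGroup V] [Module k V] [AddCommGroup W] [Module k W]
    (ρ : V →ₗ[k] V ⊗[k] C) (lam : W →ₗ[k] C ⊗[k] W) : Submodule k (V ⊗[k] W) :=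
  LinearMap.ker (LinearMap.rTensor W ρ -
    (TensorProduct.assoc k V C W).symm.toLinearMap ∘ₗ LinearMap.lTensor V lam)

end Defs

section Grading

variable {k : Type} [Field k]

/-- `σ` is the parity involution of the grading `𝒱`. -/
structure IsParity {V : Type} [AddCommGroup V] [Module k V]
    (σ : V →ₗ[k] V) (𝒱 : ZMod 2 → Submodule k V) : Prop where
  inv : ∀ v, σ (σ v) = v
  even : ∀ v, v ∈ 𝒱 0 ↔ σ v = v
  odd : ∀ v, v ∈ 𝒱 1 ↔ σ v = -v

lemma univ_zmod2 : (Set.univ : Set (ZMod 2)) = {0, 1} := by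
  ext i
  fin_cases i
  · exact ⟨fun _ => Or.inl rfl, fun _ => trivial⟩
  · exact ⟨fun _ => Or.inr rfl, fun _ => trivial⟩

lemma self_eq_neg' (h2 : (2 : k) ≠ 0) {V : Type} [AddCommGroup V] [Module k V] {v : V}
    (h : v = -v) : v = 0 := by
  have : (2 : k) • v = 0 := by
    rw [two_smul]; nth_rewrite 2 [h]; simp
  exact (smul_eq_zero.mp this).resolve_left h2

lemma exists_parity (h2 : (2 : k) ≠ 0) {V : Type} [AddCommGroup V] [Module k V]
    (𝒱 : ZMod 2 → Submodule k V) (D : DirectSum.Decomposition 𝒱) :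
    ∃ σ : V →ₗ[k] V, IsParity σ 𝒱 := by
  have hc : IsCompl (𝒱 0) (𝒱 1) :=
    (DirectSum.isInternal_submodule_iff_isCompl 𝒱 (by decide) univ_zmod2).mp
      (DirectSum.Decomposition.isInternal 𝒱)
  let p := (𝒱 0).projection (𝒱 1) hc
  let q := (𝒱 1).projection (𝒱 0) hc.symm
  have h0 : ∀ v ∈ 𝒱 0, (p - q) v = v := by
    intro v hv
    have h1 : p v = v := Submodule.projection_apply_of_mem_left hc hv
    have h3 : q v = 0 := (Submodule.projection_apply_eq_zero_iff hc.symm).2 hv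
    simp [h1, h3]
  have h1 : ∀ v ∈ 𝒱 1, (p - q) v = -v := by
    intro v hv
    have h1 : q v = v := Submodule.projection_apply_of_mem_left hc.symm hv
    have h3 : p v = 0 := (Submodule.projection_apply_eq_zero_iff hc).2 hv
    simp [h1, h3]
  have hs : ∀ v, p v + q v = v := fun v => Submodule.projection_add_projection_eq_self hc v
  have hp : ∀ v, p v ∈ 𝒱 0 := fun v => Submodule.projection_apply_mem hc v
  have hq : ∀ v, q v ∈ 𝒱 1 := fun v => Submodule.projection_apply_mem hc.symm v
  refine ⟨p - q, ?_, ?_, ?_⟩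
  · intro v
    have : (p - q) v = p v - q v := rfl
    rw [this, map_sub, h0 _ (hp v), h1 _ (hq v), sub_neg_eq_add, hs]
  · intro v
    refine ⟨h0 v, fun h => ?_⟩
    have e1 : p v - q v = v := h
    have e2 := hs v
    have : q v = 0 := self_eq_neg' h2 (by
      have : p v - q v = p v + q v := e1.trans e2.symm
      have := congrArg (fun x => x - p v) this
      simp at this; exact this.symm)
    rw [← e2, this, add_zero]; exact hp v
  · intro v
    refine ⟨h1 v, fun h => ?_⟩
    have e1 : p v - q v = -v := h
    have e2 := hs v
    have : p v = 0 := self_eq_neg' h2 (by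
      have : p v - q v = -(p v + q v) := by rw [e1, e2]
      have := congrArg (fun x => x + q v) this
      simp at this; exact this)
    rw [← e2, this, zero_add]; exact hq v

lemma half_add_half (h2 : (2 : k) ≠ 0) {V : Type} [AddCommGroup V] [Module k V] (v : V) :
    (2 : k)⁻¹ • (v + v) = v := by
  rw [← two_smul k v, smul_smul, inv_mul_cancel₀ h2, one_smul]

/-- Even and odd parts. -/
lemma even_part {V : Type} [AddCommGroup V] [Module k V]
    {σ : V →ₗ[k] V} (hσ : ∀ v, σ (σ v) = v) (v : V) :
    σ ((2 : k)⁻¹ • (v + σ v)) = (2 : k)⁻¹ • (v + σ v) := by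
  rw [map_smul, map_add, hσ, add_comm]

lemma odd_part {V : Type} [AddCommGroup V] [Module k V]
    {σ : V →ₗ[k] V} (hσ : ∀ v, σ (σ v) = v) (v : V) :
    σ ((2 : k)⁻¹ • (v - σ v)) = -((2 : k)⁻¹ • (v - σ v)) := by
  rw [map_smul, map_sub, hσ, ← smul_neg, neg_sub]

lemma even_add_odd (h2 : (2 : k) ≠ 0) {V : Type} [AddCommGroup V] [Module k V]
    (σ : V →ₗ[k] V) (v : V) :
    (2 : k)⁻¹ • (v + σ v) + (2 : k)⁻¹ • (v - σ v) = v := by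
  rw [← smul_add]
  have : v + σ v + (v - σ v) = v + v := by abel
  rw [this, half_add_half h2]

lemma exists_grading (h2 : (2 : k) ≠ 0) {V : Type} [AddCommGroup V] [Module k V]
    (σ : V →ₗ[k] V) (hσ : ∀ v, σ (σ v) = v) :
    ∃ (𝒱 : ZMod 2 → Submodule k V) (_ : DirectSum.Decomposition 𝒱), IsParity σ 𝒱 := by
  let 𝒱 : ZMod 2 → Submodule k V := fun i =>
    if i = 0 then LinearMap.ker (σ - LinearMap.id) else LinearMap.ker (σ + LinearMap.id)
  have hP : IsParity σ 𝒱 := by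
    refine ⟨hσ, ?_, ?_⟩
    · intro v; simp [𝒱, sub_eq_zero]
    · intro v; simp [𝒱, eq_neg_iff_add_eq_zero]
  have hc : IsCompl (𝒱 0) (𝒱 1) := by
    constructor
    · rw [Submodule.disjoint_def]
      intro v hv hv'
      rw [hP.even] at hv; rw [hP.odd] at hv'
      exact self_eq_neg' h2 (hv.symm.trans hv')
    · rw [codisjoint_iff, eq_top_iff]
      intro v _
      rw [← even_add_odd h2 σ v]
      exact Submodule.add_mem_sup ((hP.even _).2 (even_part hσ v)) ((hP.odd _).2 (odd_part hσ v))
  have hi := (DirectSum.isInternal_submodule_iff_isCompl 𝒱 (by decide) univ_zmod2).mpr hc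
  exact ⟨𝒱, hi.chooseDecomposition, hP⟩

variable {V W : Type} [AddCommGroup V] [Module k V] [AddCommGroup W] [Module k W]

lemma map_map_inv {σ : V →ₗ[k] V} {τ : W →ₗ[k] W} (hσ : ∀ v, σ (σ v) = v) (hτ : ∀ v, τ (τ v) = v)
    (z : V ⊗[k] W) : TensorProduct.map σ τ (TensorProduct.map σ τ z) = z := by
  induction z with
  | zero => simp
  | tmul a b => simp [hσ, hτ]
  | add a b ha hb => simp [ha, hb]

lemma gradedTensorMem_tmul {𝒱 : ZMod 2 → Submodule k V} {𝒲 : ZMod 2 → Submodule k W}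
    {n p : ZMod 2} {v : V} {w : W} (hv : v ∈ 𝒱 p) (hw : w ∈ 𝒲 (n - p)) :
    gradedTensorMem 𝒱 𝒲 n (v ⊗ₜ w) := by
  refine Submodule.mem_iSup_of_mem p ⟨(⟨v, hv⟩ : 𝒱 p) ⊗ₜ (⟨w, hw⟩ : 𝒲 (n - p)), ?_⟩
  simp

lemma tensor_even_odd_aux {σ : V →ₗ[k] V} {τ : W →ₗ[k] W}
    {𝒱 : ZMod 2 → Submodule k V} {𝒲 : ZMod 2 → Submodule k W}
    (n p : ZMod 2) (c : k)
    (H : ∀ (v : 𝒱 p) (w : 𝒲 (n - p)), σ v ⊗ₜ[k] τ w = c • ((v : V) ⊗ₜ[k] (w : W))) :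
    LinearMap.range (TensorProduct.map (𝒱 p).subtype (𝒲 (n - p)).subtype) ≤
      LinearMap.ker (TensorProduct.map σ τ - c • LinearMap.id) := by
  rintro _ ⟨z, rfl⟩
  rw [LinearMap.mem_ker, LinearMap.sub_apply, sub_eq_zero]
  induction z with
  | zero => simp
  | tmul a b => simpa using H a b
  | add a b ha hb => simp only [map_add, ha, hb]

lemma IsParity.tensor_even (h2 : (2 : k) ≠ 0) {σ : V →ₗ[k] V} {τ : W →ₗ[k] W}
    {𝒱 : ZMod 2 → Submodule k V} {𝒲 : ZMod 2 → Submodule k W}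
    (hσ : IsParity σ 𝒱) (hτ : IsParity τ 𝒲) (z : V ⊗[k] W) :
    gradedTensorMem 𝒱 𝒲 0 z ↔ TensorProduct.map σ τ z = z := by
  constructor
  · intro h
    have : (⨆ p : ZMod 2, LinearMap.range (TensorProduct.map (𝒱 p).subtype (𝒲 (0 - p)).subtype))
        ≤ LinearMap.ker (TensorProduct.map σ τ - (1 : k) • LinearMap.id) := by
      refine iSup_le fun p => tensor_even_odd_aux 0 p 1 ?_
      rintro ⟨v, hv⟩ ⟨w, hw⟩
      fin_cases p
      · have h1 := (hσ.even v).1 hv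
        have h3 := (hτ.even w).1 hw
        simp [h1, h3]
      · have h1 := (hσ.odd v).1 hv
        have h3 := (hτ.odd w).1 hw
        simp [h1, h3, TensorProduct.neg_tmul, TensorProduct.tmul_neg]
    have := this h
    simpa [sub_eq_zero] using this
  · intro h
    have key : ∀ z : V ⊗[k] W,
        gradedTensorMem 𝒱 𝒲 0 ((2 : k)⁻¹ • (z + TensorProduct.map σ τ z)) := by
      intro z
      induction z with
      | zero => simp [gradedTensorMem]
      | add a b ha hb =>
        have := Submodule.add_mem _ ha hb
        rw [← smul_add] at this
        rw [map_add, add_add_add_comm]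
        exact this
      | tmul a b =>
        have e : (2 : k)⁻¹ • (a ⊗ₜ[k] b + TensorProduct.map σ τ (a ⊗ₜ[k] b)) =
          ((2 : k)⁻¹ • (a + σ a)) ⊗ₜ[k] ((2 : k)⁻¹ • (b + τ b)) +
          ((2 : k)⁻¹ • (a - σ a)) ⊗ₜ[k] ((2 : k)⁻¹ • (b - τ b)) := by
          simp only [TensorProduct.map_tmul, ← TensorProduct.smul_tmul', TensorProduct.tmul_smul,
            TensorProduct.add_tmul, TensorProduct.tmul_add, TensorProduct.sub_tmul,
            TensorProduct.tmul_sub, smul_add, smul_sub, smul_smul]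
          match_scalars <;> field_simp <;> norm_num
        rw [e]
        exact Submodule.add_mem _
          (gradedTensorMem_tmul (p := 0) ((hσ.even _).2 (even_part hσ.inv a))
            ((hτ.even _).2 (even_part hτ.inv b)))
          (gradedTensorMem_tmul (p := 1) ((hσ.odd _).2 (odd_part hσ.inv a))
            ((hτ.odd _).2 (odd_part hτ.inv b)))
    have := key z
    rwa [h, half_add_half h2] at this

lemma IsParity.tensor_odd (h2 : (2 : k) ≠ 0) {σ : V →ₗ[k] V} {τ : W →ₗ[k] W}
    {𝒱 : ZMod 2 → Submodule k V} {𝒲 : ZMod 2 → Submodule k W}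
    (hσ : IsParity σ 𝒱) (hτ : IsParity τ 𝒲) (z : V ⊗[k] W) :
    gradedTensorMem 𝒱 𝒲 1 z ↔ TensorProduct.map σ τ z = -z := by
  constructor
  · intro h
    have : (⨆ p : ZMod 2, LinearMap.range (TensorProduct.map (𝒱 p).subtype (𝒲 (1 - p)).subtype))
        ≤ LinearMap.ker (TensorProduct.map σ τ - (-1 : k) • LinearMap.id) := by
      refine iSup_le fun p => tensor_even_odd_aux 1 p (-1) ?_
      rintro ⟨v, hv⟩ ⟨w, hw⟩
      fin_cases p
      · have h1 := (hσ.even v).1 hv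
        have h3 := (hτ.odd w).1 hw
        simp [h1, h3, TensorProduct.tmul_neg]
      · have h1 := (hσ.odd v).1 hv
        have h3 := (hτ.even w).1 hw
        simp [h1, h3, TensorProduct.neg_tmul]
    have := this h
    simpa [add_eq_zero_iff_eq_neg] using this
  · intro h
    have key : ∀ z : V ⊗[k] W,
        gradedTensorMem 𝒱 𝒲 1 ((2 : k)⁻¹ • (z - TensorProduct.map σ τ z)) := by
      intro z
      induction z with
      | zero => simp [gradedTensorMem]
      | add a b ha hb =>
        have := Submodule.add_mem _ ha hb
        rw [← smul_add] at this
        rw [map_add, add_sub_add_comm]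
        exact this
      | tmul a b =>
        have e : (2 : k)⁻¹ • (a ⊗ₜ[k] b - TensorProduct.map σ τ (a ⊗ₜ[k] b)) =
          ((2 : k)⁻¹ • (a + σ a)) ⊗ₜ[k] ((2 : k)⁻¹ • (b - τ b)) +
          ((2 : k)⁻¹ • (a - σ a)) ⊗ₜ[k] ((2 : k)⁻¹ • (b + τ b)) := by
          simp only [TensorProduct.map_tmul, ← TensorProduct.smul_tmul', TensorProduct.tmul_smul,
            TensorProduct.add_tmul, TensorProduct.tmul_add, TensorProduct.sub_tmul,
            TensorProduct.tmul_sub, smul_add, smul_sub, smul_smul]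
          match_scalars <;> field_simp <;> norm_num
        rw [e]
        exact Submodule.add_mem _
          (gradedTensorMem_tmul (p := 0) ((hσ.even _).2 (even_part hσ.inv a))
            ((hτ.odd _).2 (odd_part hτ.inv b)))
          (gradedTensorMem_tmul (p := 1) ((hσ.odd _).2 (odd_part hσ.inv a))
            ((hτ.even _).2 (even_part hτ.inv b)))
    have := key z
    rwa [h, sub_neg_eq_add, half_add_half h2] at this

/-- A map is even iff it commutes with parity. -/
lemma even_iff (h2 : (2 : k) ≠ 0) {σ : V →ₗ[k] V} {τ : W →ₗ[k] W}
    {P : ZMod 2 → W → Prop} {𝒱 : ZMod 2 → Submodule k V}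
    (hσ : IsParity σ 𝒱) (h0 : ∀ w, P 0 w ↔ τ w = w) (h1 : ∀ w, P 1 w ↔ τ w = -w)
    (f : V →ₗ[k] W) :
    (∀ i, ∀ v ∈ 𝒱 i, P i (f v)) ↔ ∀ v, f (σ v) = τ (f v) := by
  constructor
  · intro h v
    have e0 := (h0 _).1 (h 0 _ ((hσ.even _).2 (even_part hσ.inv v)))
    have e1 := (h1 _).1 (h 1 _ ((hσ.odd _).2 (odd_part hσ.inv v)))
    have e0' := even_part hσ.inv v
    have e1' := odd_part hσ.inv v
    have e := even_add_odd h2 σ v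
    rw [← e]
    simp only [map_add σ, e0', e1', map_add f, map_add τ, e0, e1, map_neg f]
  · intro h i v hv
    fin_cases i
    · refine (h0 _).2 ?_
      rw [← h, (hσ.even v).1 hv]
    · refine (h1 _).2 ?_
      rw [← h, (hσ.odd v).1 hv, map_neg]

end Grading

section Comod

variable {k : Type} [Field k] {C : Type} [AddCommGroup C] [Module k C]
variable {U V W E F : Type} [AddCommGroup U] [Module k U] [AddCommGroup V] [Module k V]
  [AddCommGroup W] [Module k W] [AddCommGroup E] [Module k E] [AddCommGroup F] [Module k F]

/-- contraction of the right factor against a functional -/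
noncomputable def ctr (U : Type) [AddCommGroup U] [Module k U] (φ : C →ₗ[k] k) :
    U ⊗[k] C →ₗ[k] U :=
  (TensorProduct.rid k U).toLinearMap ∘ₗ LinearMap.lTensor U φ

@[simp] lemma ctr_tmul (φ : C →ₗ[k] k) (u : U) (c : C) : ctr U φ (u ⊗ₜ c) = φ c • u := by
  simp [ctr]

lemma ctr_rTensor (φ : C →ₗ[k] k) (f : U →ₗ[k] V) (z : U ⊗[k] C) :
    ctr V φ (LinearMap.rTensor C f z) = f (ctr U φ z) := by
  induction z with
  | zero => simp
  | tmul a b => simp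
  | add a b ha hb => simp only [map_add, ha, hb]

lemma eq_zero_of_ctr (z : U ⊗[k] C) (h : ∀ φ : C →ₗ[k] k, ctr U φ z = 0) : z = 0 := by
  classical
  let b := Module.Basis.ofVectorSpace k C
  apply (TensorProduct.equivFinsuppOfBasisRight (M := U) b).injective
  ext i
  rw [TensorProduct.equivFinsuppOfBasisRight_apply]
  exact (h (b.coord i)).trans (by simp)

lemma eq_of_ctr {z w : U ⊗[k] C} (h : ∀ φ : C →ₗ[k] k, ctr U φ z = ctr U φ w) : z = w := by
  rw [← sub_eq_zero]
  apply eq_zero_of_ctr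
  intro φ
  rw [map_sub, h, sub_self]

/-- action of the dual algebra -/
noncomputable def act (ρ : U →ₗ[k] U ⊗[k] C) (φ : C →ₗ[k] k) : U →ₗ[k] U := ctr U φ ∘ₗ ρ

lemma comodHom_iff (ρU : U →ₗ[k] U ⊗[k] C) (ρV : V →ₗ[k] V ⊗[k] C) (f : U →ₗ[k] V) :
    (LinearMap.rTensor C f ∘ₗ ρU = ρV ∘ₗ f) ↔ ∀ φ u, f (act ρU φ u) = act ρV φ (f u) := by
  constructor
  · intro h φ u
    have := congrArg (ctr V φ) (LinearMap.congr_fun h u)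
    simpa [ctr_rTensor, act] using this
  · intro h
    ext u
    apply eq_of_ctr
    intro φ
    simpa [ctr_rTensor, act] using h φ u

lemma act_counit {Δ : C →ₗ[k] C ⊗[k] C} {ε : C →ₗ[k] k} {ρ : U →ₗ[k] U ⊗[k] C}
    (h : IsRightComod Δ ε ρ) (u : U) : act ρ ε u = u :=
  LinearMap.congr_fun h.2 u

lemma act_act {Δ : C →ₗ[k] C ⊗[k] C} {ε : C →ₗ[k] k} {ρ : U →ₗ[k] U ⊗[k] C}
    (h : IsRightComod Δ ε ρ) (φ ψ : C →ₗ[k] k) (u : U) :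
    act ρ ψ (act ρ φ u) = act ρ (ψ ∘ₗ ctr C φ ∘ₗ Δ) u := by
  have h1 := LinearMap.congr_fun h.1 u
  simp only [LinearMap.comp_apply] at h1
  have a1 : ∀ z : U ⊗[k] C, ρ (ctr U φ z) = ctr (U ⊗[k] C) φ (LinearMap.rTensor C ρ z) :=
    fun z => (ctr_rTensor φ ρ z).symm
  have a2 : ∀ z : (U ⊗[k] C) ⊗[k] C, ctr (U ⊗[k] C) φ z =
      LinearMap.lTensor U (ctr C φ) (TensorProduct.assoc k U C C z) := by
    intro z
    have : ctr (U ⊗[k] C) φ = LinearMap.lTensor U (ctr C φ) ∘ₗ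
        (TensorProduct.assoc k U C C).toLinearMap := by
      ext a b c; simp
    exact LinearMap.congr_fun this z
  have a3 : ∀ z : U ⊗[k] C, ctr U ψ (LinearMap.lTensor U (ctr C φ) (LinearMap.lTensor U Δ z)) =
      ctr U (ψ ∘ₗ ctr C φ ∘ₗ Δ) z := by
    intro z
    induction z with
    | zero => simp
    | tmul a b => simp
    | add a b ha hb => simp only [map_add, ha, hb]
  simp only [act, LinearMap.comp_apply]
  rw [a1, a2]
  erw [h1]
  exact a3 _

lemma act_parity {ρ : U →ₗ[k] U ⊗[k] C} {σ : U →ₗ[k] U} {σC : C →ₗ[k] C}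
    (h : ∀ u, ρ (σ u) = TensorProduct.map σ σC (ρ u)) (φ : C →ₗ[k] k) (u : U) :
    act ρ φ (σ u) = σ (act ρ (φ ∘ₗ σC) u) := by
  have a3 : ∀ z : U ⊗[k] C, ctr U φ (TensorProduct.map σ σC z) = σ (ctr U (φ ∘ₗ σC) z) := by
    intro z
    induction z with
    | zero => simp
    | tmul a b => simp
    | add a b ha hb => simp only [map_add, ha, hb]
  simp only [act, LinearMap.comp_apply, h, a3]

/-- the orbit of an element under the dual algebra -/
noncomputable def ctrL (z : U ⊗[k] C) : (C →ₗ[k] k) →ₗ[k] U where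
  toFun φ := ctr U φ z
  map_add' φ ψ := by simp [ctr, LinearMap.lTensor_add]
  map_smul' c φ := by simp [ctr, LinearMap.lTensor_smul]

lemma ctrL_finite (z : U ⊗[k] C) : (LinearMap.range (ctrL z)).FG := by
  have key : ∃ S : Submodule k U, S.FG ∧ ∀ φ, ctr U φ z ∈ S := by
    induction z with
    | zero => exact ⟨⊥, Submodule.fg_bot, by simp⟩
    | tmul a b =>
      refine ⟨Submodule.span k {a}, Submodule.fg_span_singleton a, fun φ => ?_⟩
      rw [ctr_tmul]
      exact Submodule.smul_mem _ _ (Submodule.mem_span_singleton_self a)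
    | add a b ha hb =>
      obtain ⟨S, hS, h1⟩ := ha
      obtain ⟨T, hT, h2⟩ := hb
      refine ⟨S ⊔ T, hS.sup hT, fun φ => ?_⟩
      rw [map_add]
      exact Submodule.add_mem_sup (h1 φ) (h2 φ)
  obtain ⟨S, hS, h⟩ := key
  have : Module.Finite k S := Module.Finite.iff_fg.2 hS
  have hle : LinearMap.range (ctrL z) ≤ S := by
    rintro _ ⟨φ, rfl⟩; exact h φ
  exact Module.Finite.iff_fg.1 (Submodule.finiteDimensional_of_le hle)

/-- stable subspaces -/
structure Stable (ρ : U →ₗ[k] U ⊗[k] C) (σ : U →ₗ[k] U) (S : Submodule k U) : Prop where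
  act : ∀ φ, ∀ u ∈ S, act ρ φ u ∈ S
  par : ∀ u ∈ S, σ u ∈ S

lemma exists_finite_stable {Δ : C →ₗ[k] C ⊗[k] C} {ε : C →ₗ[k] k} {ρ : U →ₗ[k] U ⊗[k] C}
    (h : IsRightComod Δ ε ρ) {σ : U →ₗ[k] U} {σC : C →ₗ[k] C} (hσ : ∀ u, σ (σ u) = u)
    (hρ : ∀ u, ρ (σ u) = TensorProduct.map σ σC (ρ u)) (u : U) :
    ∃ S : Submodule k U, S.FG ∧ u ∈ S ∧ Stable ρ σ S := by
  let R := LinearMap.range (ctrL (ρ u))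
  have hR : ∀ φ, ∀ x ∈ R, act ρ φ x ∈ R := by
    rintro φ _ ⟨ψ, rfl⟩
    exact ⟨_, (act_act h ψ φ u).symm⟩
  refine ⟨R ⊔ R.map σ, (ctrL_finite _).sup ((ctrL_finite _).map σ), ?_, ?_, ?_⟩
  · exact Submodule.mem_sup_left ⟨ε, act_counit h u⟩
  · intro φ x hx
    obtain ⟨y, hy, z, hz, rfl⟩ := Submodule.mem_sup.1 hx
    obtain ⟨w, hw, rfl⟩ := hz
    rw [map_add, act_parity hρ]
    exact Submodule.add_mem_sup (hR _ _ hy) (Submodule.mem_map_of_mem (hR _ _ hw))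
  · intro x hx
    obtain ⟨y, hy, z, hz, rfl⟩ := Submodule.mem_sup.1 hx
    obtain ⟨w, hw, rfl⟩ := hz
    rw [map_add, hσ, add_comm]
    exact Submodule.add_mem_sup hw (Submodule.mem_map_of_mem hy)

lemma Stable.inf {ρ : U →ₗ[k] U ⊗[k] C} {σ : U →ₗ[k] U} {S T : Submodule k U}
    (hS : Stable ρ σ S) (hT : Stable ρ σ T) : Stable ρ σ (S ⊓ T) :=
  ⟨fun φ u hu => ⟨hS.act φ u hu.1, hT.act φ u hu.2⟩, fun u hu => ⟨hS.par u hu.1, hT.par u hu.2⟩⟩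

lemma rTensor_inj (X : Type) [AddCommGroup X] [Module k X] {f : U →ₗ[k] V}
    (hf : Function.Injective f) : Function.Injective (LinearMap.rTensor X f) :=
  Module.Flat.rTensor_preserves_injective_linearMap f hf

lemma lTensor_inj (X : Type) [AddCommGroup X] [Module k X] {f : U →ₗ[k] V}
    (hf : Function.Injective f) : Function.Injective (LinearMap.lTensor X f) :=
  Module.Flat.lTensor_preserves_injective_linearMap f hf

/-- A stable subspace is a subcomodule. -/
lemma exists_restrict {Δ : C →ₗ[k] C ⊗[k] C} {ε : C →ₗ[k] k} {ρ : U →ₗ[k] U ⊗[k] C}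
    (h : IsRightComod Δ ε ρ) {S : Submodule k U}
    (hS : ∀ φ, ∀ u ∈ S, act ρ φ u ∈ S) :
    ∃ ρS : S →ₗ[k] S ⊗[k] C, IsRightComod Δ ε ρS ∧
      LinearMap.rTensor C S.subtype ∘ₗ ρS = ρ ∘ₗ S.subtype := by
  have hinj := rTensor_inj (k := k) C S.injective_subtype
  have hmem : ∀ s : S, (ρ ∘ₗ S.subtype) s ∈ LinearMap.range (LinearMap.rTensor C S.subtype) := by
    intro s
    have hex : Function.Exact (LinearMap.rTensor C S.subtype) (LinearMap.rTensor C S.mkQ) :=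
      rTensor_exact C (LinearMap.exact_subtype_mkQ S) S.mkQ_surjective
    refine (hex _).1 ?_
    apply eq_zero_of_ctr
    intro φ
    rw [ctr_rTensor]
    exact (Submodule.Quotient.mk_eq_zero S).2 (hS φ s s.2)
  let e := LinearEquiv.ofInjective _ hinj
  let ρS : S →ₗ[k] S ⊗[k] C := e.symm.toLinearMap ∘ₗ LinearMap.codRestrict _ (ρ ∘ₗ S.subtype) hmem
  have hc : LinearMap.rTensor C S.subtype ∘ₗ ρS = ρ ∘ₗ S.subtype := by
    ext s
    have : (e (ρS s) : U ⊗[k] C) = ρ s := by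
      simp [ρS]
    simpa [e] using this
  refine ⟨ρS, ⟨?_, ?_⟩, hc⟩
  · have hinj2 := rTensor_inj (k := k) (C ⊗[k] C) S.injective_subtype
    ext s
    apply hinj2
    have hcs : ∀ s : S, LinearMap.rTensor C S.subtype (ρS s) = ρ s := LinearMap.congr_fun hc
    have h1 := LinearMap.congr_fun h.1 (s : U)
    simp only [LinearMap.comp_apply] at h1 ⊢
    have b1 : ∀ z : (S ⊗[k] C) ⊗[k] C, LinearMap.rTensor (C ⊗[k] C) S.subtype
        ((TensorProduct.assoc k S C C).toLinearMap z) =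
        (TensorProduct.assoc k U C C).toLinearMap
          (LinearMap.rTensor C (LinearMap.rTensor C S.subtype) z) := by
      intro z
      have : LinearMap.rTensor (C ⊗[k] C) S.subtype ∘ₗ (TensorProduct.assoc k S C C).toLinearMap
        = (TensorProduct.assoc k U C C).toLinearMap ∘ₗ
          (LinearMap.rTensor C (LinearMap.rTensor C S.subtype)) := by
        ext a b c; simp
      exact LinearMap.congr_fun this z
    have b2 : ∀ z : S ⊗[k] C, LinearMap.rTensor (C ⊗[k] C) S.subtype (LinearMap.lTensor S Δ z) =
        LinearMap.lTensor U Δ (LinearMap.rTensor C S.subtype z) := by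
      intro z
      rw [← LinearMap.comp_apply, ← LinearMap.comp_apply, LinearMap.rTensor_comp_lTensor,
        LinearMap.lTensor_comp_rTensor]
    rw [b1, b2, hcs, ← h1, ← LinearMap.rTensor_comp_apply, hc, LinearMap.rTensor_comp_apply, hcs]
  · ext s
    have h1 := (comodHom_iff ρS ρ S.subtype).1 hc ε s
    simp only [Submodule.subtype_apply] at h1
    rw [act_counit h] at h1
    exact h1

end Comod

section DualComod

variable {k : Type} [Field k] {C : Type} [AddCommGroup C] [Module k C]
variable {V X Y E F : Type} [AddCommGroup X] [Module k X] [AddCommGroup V] [Module k V]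
  [AddCommGroup Y] [Module k Y] [AddCommGroup E] [Module k E] [AddCommGroup F] [Module k F]

/-- `X ⊗ E^* ≃ Hom(E, X)` for finite-dimensional `E`. -/
noncomputable def evE (X E : Type) [AddCommGroup X] [Module k X] [AddCommGroup E] [Module k E]
    [Module.Finite k E] : X ⊗[k] (Module.Dual k E) ≃ₗ[k] (E →ₗ[k] X) :=
  TensorProduct.comm k X (Module.Dual k E) ≪≫ₗ dualTensorHomEquiv k E X

@[simp] lemma evE_tmul [Module.Finite k E] (x : X) (φ : Module.Dual k E) (e : E) :
    evE X E (x ⊗ₜ[k] φ) e = φ e • x := by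
  simp [evE]

lemma evE_rTensor [Module.Finite k E] (f : X →ₗ[k] Y) (t : X ⊗[k] (Module.Dual k E)) :
    evE Y E (LinearMap.rTensor _ f t) = f ∘ₗ evE X E t := by
  induction t with
  | zero => simp
  | tmul a b => ext e; simp
  | add a b ha hb => simp only [map_add, ha, hb, LinearMap.comp_add]

lemma evE_lTensor [Module.Finite k E] [Module.Finite k F] (i : E →ₗ[k] F)
    (t : X ⊗[k] (Module.Dual k F)) :
    evE X E (LinearMap.lTensor X i.dualMap t) = evE X F t ∘ₗ i := by
  induction t with
  | zero => simp
  | tmul a b => ext e; simp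
  | add a b ha hb => simp only [map_add, ha, hb, LinearMap.add_comp]

/-- the functional applied to the comodule leg -/
noncomputable def coef (ρ : E →ₗ[k] E ⊗[k] C) : Module.Dual k E →ₗ[k] (E →ₗ[k] C) where
  toFun φ := (TensorProduct.lid k C).toLinearMap ∘ₗ LinearMap.rTensor C φ ∘ₗ ρ
  map_add' φ ψ := by ext; simp [LinearMap.rTensor_add]
  map_smul' c φ := by ext; simp [LinearMap.rTensor_smul]

/-- the dual left comodule -/
noncomputable def dualCo [Module.Finite k E] (ρ : E →ₗ[k] E ⊗[k] C) :
    Module.Dual k E →ₗ[k] C ⊗[k] Module.Dual k E :=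
  (evE C E).symm.toLinearMap ∘ₗ coef ρ

lemma evE_dualCo [Module.Finite k E] (ρ : E →ₗ[k] E ⊗[k] C) (φ : Module.Dual k E) :
    evE C E (dualCo ρ φ) = coef ρ φ := by
  simp [dualCo]

lemma evE_assoc_tmul [Module.Finite k E] (x : X) (s : Y ⊗[k] Module.Dual k E) (e : E) :
    evE (X ⊗[k] Y) E ((TensorProduct.assoc k X Y _).symm (x ⊗ₜ[k] s)) e =
      x ⊗ₜ[k] evE Y E s e := by
  induction s with
  | zero => simp
  | tmul a b => simp
  | add a b ha hb => simp only [map_add, ha, hb, TensorProduct.tmul_add, LinearMap.add_apply]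

lemma evE_key [Module.Finite k E] (ρ : E →ₗ[k] E ⊗[k] C) (t : X ⊗[k] Module.Dual k E) :
    evE (X ⊗[k] C) E ((TensorProduct.assoc k X C _).symm (LinearMap.lTensor X (dualCo ρ) t)) =
      LinearMap.rTensor C (evE X E t) ∘ₗ ρ := by
  induction t with
  | zero => simp
  | add a b ha hb =>
    simp only [map_add, ha, hb, LinearMap.rTensor_add, LinearMap.add_comp]
  | tmul x φ =>
    ext e
    rw [LinearMap.lTensor_tmul, evE_assoc_tmul, evE_dualCo]
    simp only [coef, LinearMap.coe_mk, AddHom.coe_mk, LinearMap.comp_apply]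
    generalize ρ e = z
    induction z with
    | zero => simp
    | tmul a b => simp [TensorProduct.smul_tmul]
    | add a b ha hb => simp only [map_add, TensorProduct.tmul_add, ha, hb]

lemma mem_cotensor_dual [Module.Finite k E] (ρV : V →ₗ[k] V ⊗[k] C) (ρ : E →ₗ[k] E ⊗[k] C)
    (t : V ⊗[k] Module.Dual k E) :
    t ∈ cotensor ρV (dualCo ρ) ↔
      LinearMap.rTensor C (evE V E t) ∘ₗ ρ = ρV ∘ₗ evE V E t := by
  rw [cotensor, LinearMap.mem_ker, LinearMap.sub_apply, sub_eq_zero,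
    ← (evE (V ⊗[k] C) E).injective.eq_iff, evE_rTensor]
  simp only [LinearMap.comp_apply, LinearEquiv.coe_coe]
  rw [evE_key, eq_comm]

lemma dualCo_comod [Module.Finite k E] {Δ : C →ₗ[k] C ⊗[k] C} {ε : C →ₗ[k] k}
    {ρ : E →ₗ[k] E ⊗[k] C} (h : IsRightComod Δ ε ρ) : IsLeftComod Δ ε (dualCo ρ) := by
  constructor
  · ext φ
    simp only [LinearMap.comp_apply, LinearEquiv.coe_coe]
    apply (evE (C ⊗[k] C) E).injective
    rw [evE_key, evE_rTensor, evE_dualCo]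
    ext e
    have h1 := LinearMap.congr_fun h.1 e
    simp only [coef, LinearMap.coe_mk, AddHom.coe_mk, LinearMap.comp_apply,
      LinearEquiv.coe_coe] at h1 ⊢
    have b1 : ∀ z : E ⊗[k] C, LinearMap.rTensor C ((TensorProduct.lid k C).toLinearMap ∘ₗ
        LinearMap.rTensor C φ ∘ₗ ρ) z = TensorProduct.lid k (C ⊗[k] C)
          (LinearMap.rTensor (C ⊗[k] C) φ (TensorProduct.assoc k E C C
            (LinearMap.rTensor C ρ z))) := by
      intro z
      have : ∀ y : (E ⊗[k] C) ⊗[k] C, LinearMap.rTensor C ((TensorProduct.lid k C).toLinearMap ∘ₗ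
          LinearMap.rTensor C φ) y = TensorProduct.lid k (C ⊗[k] C)
          (LinearMap.rTensor (C ⊗[k] C) φ (TensorProduct.assoc k E C C y)) := by
        intro y
        have : LinearMap.rTensor C ((TensorProduct.lid k C).toLinearMap ∘ₗ
          LinearMap.rTensor C φ) = (TensorProduct.lid k (C ⊗[k] C)).toLinearMap ∘ₗ
          (LinearMap.rTensor (C ⊗[k] C) φ) ∘ₗ (TensorProduct.assoc k E C C).toLinearMap := by
          ext a b c; simp [TensorProduct.smul_tmul']
        exact LinearMap.congr_fun this y
      rw [← LinearMap.comp_assoc, LinearMap.rTensor_comp_apply, this]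
    have b2 : ∀ z : E ⊗[k] C, TensorProduct.lid k (C ⊗[k] C)
          (LinearMap.rTensor (C ⊗[k] C) φ (LinearMap.lTensor E Δ z)) =
          Δ (TensorProduct.lid k C (LinearMap.rTensor C φ z)) := by
      intro z
      induction z with
      | zero => simp
      | tmul a b => simp
      | add a b ha hb => simp only [map_add, ha, hb]
    rw [b1, h1, b2]
  · ext φ e
    have b : ∀ t : C ⊗[k] Module.Dual k E,
        TensorProduct.lid k _ (LinearMap.rTensor (Module.Dual k E) ε t) e = ε (evE C E t e) := by
      intro t
      induction t with
      | zero => simp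
      | tmul a b => simp [mul_comm]
      | add a b ha hb => simp only [map_add, ha, hb, LinearMap.add_apply]
    simp only [LinearMap.comp_apply, LinearEquiv.coe_coe, LinearMap.id_apply]
    rw [b, evE_dualCo]
    have b2 : ∀ z : E ⊗[k] C, ε (TensorProduct.lid k C (LinearMap.rTensor C φ z)) =
        φ (TensorProduct.rid k E (LinearMap.lTensor E ε z)) := by
      intro z
      induction z with
      | zero => simp
      | tmul a b => simp [mul_comm]
      | add a b ha hb => simp only [map_add, ha, hb]
    simp only [coef, LinearMap.coe_mk, AddHom.coe_mk, LinearMap.comp_apply, LinearEquiv.coe_coe]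
    rw [b2]
    exact congrArg φ (LinearMap.congr_fun h.2 e)

lemma dualCo_hom [Module.Finite k E] [Module.Finite k F] {ρE : E →ₗ[k] E ⊗[k] C}
    {ρF : F →ₗ[k] F ⊗[k] C} {i : E →ₗ[k] F} (h : LinearMap.rTensor C i ∘ₗ ρE = ρF ∘ₗ i) :
    LinearMap.lTensor C i.dualMap ∘ₗ dualCo ρF = dualCo ρE ∘ₗ i.dualMap := by
  ext φ
  apply (evE C E).injective
  simp only [LinearMap.comp_apply]
  rw [evE_lTensor, evE_dualCo, evE_dualCo]
  ext e
  have h1 := LinearMap.congr_fun h e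
  simp only [coef, LinearMap.coe_mk, AddHom.coe_mk, LinearMap.comp_apply] at h1 ⊢
  rw [← h1, ← LinearMap.rTensor_comp_apply]
  rfl

lemma dualCo_parity [Module.Finite k E] {ρ : E →ₗ[k] E ⊗[k] C} {σ : E →ₗ[k] E} {σC : C →ₗ[k] C}
    (hσC : ∀ c, σC (σC c) = c)
    (h : ∀ u, ρ (σ u) = TensorProduct.map σ σC (ρ u)) (φ : Module.Dual k E) :
    dualCo ρ (σ.dualMap φ) = TensorProduct.map σC σ.dualMap (dualCo ρ φ) := by
  apply (evE C E).injective
  have : ∀ t : C ⊗[k] Module.Dual k E, evE C E (TensorProduct.map σC σ.dualMap t) =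
      σC ∘ₗ evE C E t ∘ₗ σ := by
    intro t
    induction t with
    | zero => simp
    | tmul a b => ext e; simp
    | add a b ha hb => simp only [map_add, ha, hb, LinearMap.add_comp, LinearMap.comp_add]
  rw [this, evE_dualCo, evE_dualCo]
  ext e
  simp only [coef, LinearMap.coe_mk, AddHom.coe_mk, LinearMap.comp_apply, LinearEquiv.coe_coe, h]
  generalize ρ e = z
  induction z with
  | zero => simp
  | tmul a b => simp [hσC]
  | add a b ha hb => simp only [map_add, ha, hb]

end DualComod

section Zorn

variable {k : Type} [Field k] {C : Type} [AddCommGroup C] [Module k C]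
variable {U V : Type} [AddCommGroup U] [Module k U] [AddCommGroup V] [Module k V]

/-- partial comodule maps -/
structure PComod (ρU : U →ₗ[k] U ⊗[k] C) (σ : U →ₗ[k] U) (ρV : V →ₗ[k] V ⊗[k] C)
    (f : U →ₗ.[k] V) : Prop where
  stable : Stable ρU σ f.domain
  hom : ∀ φ (u : f.domain) (u' : f.domain), (u' : U) = act ρU φ u → f u' = act ρV φ (f u)

/-- Zorn's lemma argument. -/
lemma zorn_extend {Δ : C →ₗ[k] C ⊗[k] C} {ε : C →ₗ[k] k} {ρU : U →ₗ[k] U ⊗[k] C}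
    (h : IsRightComod Δ ε ρU) {σ : U →ₗ[k] U} {σC : C →ₗ[k] C} (hσ : ∀ u, σ (σ u) = u)
    (hρ : ∀ u, ρU (σ u) = TensorProduct.map σ σC (ρU u))
    (ρV : V →ₗ[k] V ⊗[k] C)
    (ext : ∀ (S T : Submodule k U), T.FG → Stable ρU σ S → Stable ρU σ T → ∀ hST : S ≤ T,
      ∀ f : S →ₗ[k] V, PComod ρU σ ρV ⟨S, f⟩ →
      ∃ g : T →ₗ[k] V, PComod ρU σ ρV ⟨T, g⟩ ∧ ∀ s : S, g ⟨s, hST s.2⟩ = f s)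
    (f : U →ₗ.[k] V) (hf : PComod ρU σ ρV f) :
    ∃ g : U →ₗ[k] V, (∀ φ u, g (act ρU φ u) = act ρV φ (g u)) ∧ ∀ s : f.domain, g s = f s := by
  obtain ⟨m, hfm, hm⟩ := zorn_le_nonempty₀ {f | PComod ρU σ ρV f} (by
    intro c hc hchain y hy
    have hd := hchain.directedOn
    have hne : c.Nonempty := ⟨y, hy⟩
    refine ⟨LinearPMap.sSup c hd, ⟨⟨?_, ?_⟩, ?_⟩, fun z hz => LinearPMap.le_sSup hd hz⟩
    · intro φ u hu
      rw [LinearPMap.mem_domain_sSup_iff hne hd] at hu ⊢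
      obtain ⟨p, hp, hu⟩ := hu
      exact ⟨p, hp, (hc hp).stable.act φ u hu⟩
    · intro u hu
      rw [LinearPMap.mem_domain_sSup_iff hne hd] at hu ⊢
      obtain ⟨p, hp, hu⟩ := hu
      exact ⟨p, hp, (hc hp).stable.par u hu⟩
    · rintro φ ⟨u, hu⟩ ⟨u', hu'⟩ huu
      obtain ⟨p, hp, hup⟩ := (LinearPMap.mem_domain_sSup_iff hne hd).1 hu
      have hup' : u' ∈ p.domain := by
        have : u' = _ := huu
        rw [this]
        exact (hc hp).stable.act φ u hup
      have e1 := LinearPMap.sSup_apply hd hp ⟨u, hup⟩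
      have e2 := LinearPMap.sSup_apply hd hp ⟨u', hup'⟩
      exact e2.trans (((hc hp).hom φ ⟨u, hup⟩ ⟨u', hup'⟩ huu).trans
        (congrArg (act ρV φ) e1.symm))) f hf
  have hmP : PComod ρU σ ρV m := hm.1
  have htop : ∀ u, u ∈ m.domain := by
    intro u
    obtain ⟨T, hTfg, huT, hT⟩ := exists_finite_stable h hσ hρ u
    let S := m.domain ⊓ T
    have hS : Stable ρU σ S := hmP.stable.inf hT
    let fS : S →ₗ[k] V := m.toFun ∘ₗ Submodule.inclusion inf_le_left
    obtain ⟨g, hg, hgS⟩ := ext S T hTfg hS hT inf_le_right fS ⟨hS, by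
      rintro φ ⟨u, hu⟩ ⟨u', hu'⟩ huu
      exact hmP.hom φ ⟨u, hu.1⟩ ⟨u', hu'.1⟩ huu⟩
    let g' : U →ₗ.[k] V := ⟨T, g⟩
    have hagree : ∀ (x : m.domain) (y : g'.domain), (x : U) = y → m x = g' y := by
      rintro ⟨x, hx⟩ ⟨y, hy⟩ hxy
      obtain rfl : x = y := hxy
      exact (hgS ⟨x, hx, hy⟩).symm
    have hP : PComod ρU σ ρV (m.sup g' hagree) := by
      refine ⟨⟨?_, ?_⟩, ?_⟩
      · intro φ u hu
        obtain ⟨x, hx, y, hy, rfl⟩ := Submodule.mem_sup.1 hu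
        rw [map_add]
        exact Submodule.add_mem_sup (hmP.stable.act _ _ hx) (hT.act _ _ hy)
      · intro u hu
        obtain ⟨x, hx, y, hy, rfl⟩ := Submodule.mem_sup.1 hu
        rw [map_add]
        exact Submodule.add_mem_sup (hmP.stable.par _ hx) (hT.par _ hy)
      · rintro φ ⟨u, hu⟩ ⟨u', hu'⟩ huu
        obtain ⟨x, hx, y, hy, hxy⟩ := Submodule.mem_sup.1 hu
        have huu' : u' = act ρU φ u := huu
        have e1 := LinearPMap.sup_apply hagree ⟨x, hx⟩ ⟨y, hy⟩ ⟨u, hu⟩ hxy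
        have e2 := LinearPMap.sup_apply hagree ⟨_, hmP.stable.act φ _ hx⟩ ⟨_, hT.act φ _ hy⟩
          ⟨u', hu'⟩ (by
            show act ρU φ x + act ρU φ y = u'
            rw [huu', ← hxy, map_add])
        refine e2.trans (Eq.trans ?_ (congrArg (act ρV φ) e1.symm))
        rw [map_add]
        exact congrArg₂ (· + ·) (hmP.hom φ ⟨x, hx⟩ _ rfl) (hg.hom φ ⟨y, hy⟩ _ rfl)
    have hle := hm.2 hP (LinearPMap.left_le_sup m g' hagree)
    exact hle.1 (Submodule.mem_sup_right huT)
  let g : U →ₗ[k] V := m.toFun ∘ₗ LinearMap.codRestrict m.domain LinearMap.id htop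
  refine ⟨g, ?_, ?_⟩
  · intro φ u
    exact hmP.hom φ ⟨u, htop u⟩ ⟨_, htop _⟩ rfl
  · intro s
    exact (hfm.2 (x := s) (y := ⟨s, htop s⟩) rfl).symm

end Zorn

section Cofree

variable {k : Type} [Field k] {C : Type} [AddCommGroup C] [Module k C]
variable {V W W'' : Type} [AddCommGroup V] [Module k V] [AddCommGroup W] [Module k W]
  [AddCommGroup W''] [Module k W'']

/-- the cofree comodule `V ⊗ C` -/
noncomputable def cofree (V : Type) [AddCommGroup V] [Module k V] (Δ : C →ₗ[k] C ⊗[k] C) :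
    V ⊗[k] C →ₗ[k] (V ⊗[k] C) ⊗[k] C :=
  (TensorProduct.assoc k V C C).symm.toLinearMap ∘ₗ LinearMap.lTensor V Δ

lemma cofree_tmul (Δ : C →ₗ[k] C ⊗[k] C) (v : V) (c : C) :
    cofree V Δ (v ⊗ₜ c) = (TensorProduct.assoc k V C C).symm (v ⊗ₜ Δ c) := by
  simp [cofree]

lemma cofree_comod {Δ : C →ₗ[k] C ⊗[k] C} {ε : C →ₗ[k] k} (hC : IsCoalg Δ ε) :
    IsRightComod Δ ε (cofree V Δ) := by
  constructor
  · ext v c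
    have h1 := LinearMap.congr_fun hC.1 c
    simp only [LinearMap.comp_apply, LinearEquiv.coe_coe, TensorProduct.AlgebraTensorModule.curry_apply,
      LinearMap.restrictScalars_self, TensorProduct.curry_apply, cofree_tmul] at h1 ⊢
    apply (TensorProduct.assoc k V C (C ⊗[k] C)).injective
    have b1 : ∀ z : C ⊗[k] C, TensorProduct.assoc k V C (C ⊗[k] C)
        (TensorProduct.assoc k (V ⊗[k] C) C C (LinearMap.rTensor C (cofree V Δ)
          ((TensorProduct.assoc k V C C).symm (v ⊗ₜ z)))) =
        v ⊗ₜ (TensorProduct.assoc k C C C (LinearMap.rTensor C Δ z)) := by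
      intro z
      induction z with
      | zero => simp
      | add a b ha hb => simp only [map_add, TensorProduct.tmul_add, ha, hb]
      | tmul a b =>
        simp only [TensorProduct.assoc_symm_tmul, LinearMap.rTensor_tmul, cofree_tmul]
        generalize Δ a = y
        induction y with
        | zero => simp
        | add a b ha hb => simp only [map_add, TensorProduct.tmul_add, TensorProduct.add_tmul, ha, hb]
        | tmul c d => simp
    have b2 : ∀ z : C ⊗[k] C, TensorProduct.assoc k V C (C ⊗[k] C)
        (LinearMap.lTensor (V ⊗[k] C) Δ ((TensorProduct.assoc k V C C).symm (v ⊗ₜ z))) =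
        v ⊗ₜ (LinearMap.lTensor C Δ z) := by
      intro z
      induction z with
      | zero => simp
      | add a b ha hb => simp only [map_add, TensorProduct.tmul_add, ha, hb]
      | tmul a b => simp
    rw [b1, b2, h1]
  · ext v c
    have h1 := LinearMap.congr_fun hC.2.1 c
    simp only [LinearMap.comp_apply, LinearEquiv.coe_coe, TensorProduct.AlgebraTensorModule.curry_apply,
      LinearMap.restrictScalars_self, TensorProduct.curry_apply, cofree_tmul, LinearMap.id_apply]
      at h1 ⊢
    have b : ∀ z : C ⊗[k] C, TensorProduct.rid k (V ⊗[k] C) (LinearMap.lTensor (V ⊗[k] C) ε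
        ((TensorProduct.assoc k V C C).symm (v ⊗ₜ z))) =
        v ⊗ₜ (TensorProduct.rid k C (LinearMap.lTensor C ε z)) := by
      intro z
      induction z with
      | zero => simp
      | add a b ha hb => simp only [map_add, TensorProduct.tmul_add, ha, hb]
      | tmul a b => simp
    rw [b, h1]

lemma cofree_parity {Δ : C →ₗ[k] C ⊗[k] C} {σ : V →ₗ[k] V} {σC : C →ₗ[k] C}
    (hΔ : ∀ c, Δ (σC c) = TensorProduct.map σC σC (Δ c)) (z : V ⊗[k] C) :
    cofree V Δ (TensorProduct.map σ σC z) =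
      TensorProduct.map (TensorProduct.map σ σC) σC (cofree V Δ z) := by
  induction z with
  | zero => simp
  | add a b ha hb => simp only [map_add, ha, hb]
  | tmul v c =>
    simp only [TensorProduct.map_tmul, cofree_tmul, hΔ]
    generalize Δ c = y
    induction y with
    | zero => simp
    | add a b ha hb => simp only [map_add, TensorProduct.tmul_add, ha, hb]
    | tmul c d => simp

lemma mem_cotensor {ρ : V →ₗ[k] V ⊗[k] C} {lam : W →ₗ[k] C ⊗[k] W} {z : V ⊗[k] W} :
    z ∈ cotensor ρ lam ↔ LinearMap.rTensor W ρ z =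
      (TensorProduct.assoc k V C W).symm (LinearMap.lTensor V lam z) := by
  rw [cotensor, LinearMap.mem_ker, LinearMap.sub_apply, sub_eq_zero]
  rfl

/-- naturality of the cotensor equation -/
lemma cotensor_nat (ρ : V →ₗ[k] V ⊗[k] C) {lam : W →ₗ[k] C ⊗[k] W}
    {lam'' : W'' →ₗ[k] C ⊗[k] W''} {g : W →ₗ[k] W''}
    (hg : LinearMap.lTensor C g ∘ₗ lam = lam'' ∘ₗ g) (z : V ⊗[k] W) :
    (TensorProduct.assoc k V C W'').symm (LinearMap.lTensor V lam'' (LinearMap.lTensor V g z)) =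
      LinearMap.lTensor (V ⊗[k] C) g ((TensorProduct.assoc k V C W).symm
        (LinearMap.lTensor V lam z)) := by
  rw [← LinearMap.lTensor_comp_apply, ← hg, LinearMap.lTensor_comp_apply]
  generalize LinearMap.lTensor V lam z = y
  have : (TensorProduct.assoc k V C W'').symm.toLinearMap ∘ₗ
      LinearMap.lTensor V (LinearMap.lTensor C g) =
      LinearMap.lTensor (V ⊗[k] C) g ∘ₗ (TensorProduct.assoc k V C W).symm.toLinearMap := by
    apply TensorProduct.ext_threefold'
    intro v c w
    simp
  exact LinearMap.congr_fun this y

/-- A retraction of `ρ` yields exactness. -/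
lemma exact_of_retract {Δ : C →ₗ[k] C ⊗[k] C} {ε : C →ₗ[k] k} {ρ : V →ₗ[k] V ⊗[k] C}
    {r : V ⊗[k] C →ₗ[k] V} (hr : LinearMap.rTensor C r ∘ₗ cofree V Δ = ρ ∘ₗ r)
    (hrρ : r ∘ₗ ρ = LinearMap.id) {lam : W →ₗ[k] C ⊗[k] W}
    {lam'' : W'' →ₗ[k] C ⊗[k] W''} (hlam : IsLeftComod Δ ε lam) {g : W →ₗ[k] W''}
    (hg : LinearMap.lTensor C g ∘ₗ lam = lam'' ∘ₗ g) (hs : Function.Surjective g)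
    (z'' : V ⊗[k] W'') (hz : z'' ∈ cotensor ρ lam'') :
    ∃ z ∈ cotensor ρ lam, LinearMap.lTensor V g z = z'' := by
  obtain ⟨y, rfl⟩ := LinearMap.lTensor_surjective V hs z''
  refine ⟨LinearMap.rTensor W r ((TensorProduct.assoc k V C W).symm (LinearMap.lTensor V lam y)),
    ?_, ?_⟩
  · rw [mem_cotensor, ← LinearMap.rTensor_comp_apply, ← hr, LinearMap.rTensor_comp_apply]
    clear hz
    induction y with
    | zero => simp
    | add a b ha hb => simp only [map_add, ha, hb]
    | tmul v w =>
      have h1 := LinearMap.congr_fun hlam.1 w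
      simp only [LinearMap.comp_apply, LinearEquiv.coe_coe, LinearMap.lTensor_tmul] at h1 ⊢
      have b1 : ∀ t : C ⊗[k] W, LinearMap.rTensor W (cofree V Δ)
          ((TensorProduct.assoc k V C W).symm (v ⊗ₜ t)) =
          LinearMap.rTensor W (TensorProduct.assoc k V C C).symm.toLinearMap
            ((TensorProduct.assoc k V (C ⊗[k] C) W).symm (v ⊗ₜ LinearMap.rTensor W Δ t)) := by
        intro t
        induction t with
        | zero => simp
        | add a b ha hb => simp only [map_add, TensorProduct.tmul_add, ha, hb]
        | tmul a b => simp [cofree_tmul]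
      have b2 : ∀ t : C ⊗[k] W, (TensorProduct.assoc k V C W).symm
          (LinearMap.lTensor V lam (LinearMap.rTensor W r
            ((TensorProduct.assoc k V C W).symm (v ⊗ₜ t)))) =
          LinearMap.rTensor W (LinearMap.rTensor C r)
          (LinearMap.rTensor W (TensorProduct.assoc k V C C).symm.toLinearMap
            ((TensorProduct.assoc k V (C ⊗[k] C) W).symm
            (v ⊗ₜ (TensorProduct.assoc k C C W).symm (LinearMap.lTensor C lam t)))) := by
        intro t
        induction t with
        | zero => simp
        | add a b ha hb => simp only [map_add, TensorProduct.tmul_add, ha, hb]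
        | tmul a b =>
          simp only [TensorProduct.assoc_symm_tmul, LinearMap.rTensor_tmul, LinearMap.lTensor_tmul]
          generalize lam b = y
          induction y with
          | zero => simp
          | add a b ha hb => simp only [map_add, TensorProduct.tmul_add, ha, hb]
          | tmul c d => simp
      rw [b1, b2, h1]
  · rw [mem_cotensor, cotensor_nat ρ hg] at hz
    have : ∀ t : (V ⊗[k] C) ⊗[k] W, LinearMap.lTensor V g (LinearMap.rTensor W r t) =
        LinearMap.rTensor W'' r (LinearMap.lTensor (V ⊗[k] C) g t) := by
      intro t
      rw [← LinearMap.comp_apply, ← LinearMap.comp_apply, LinearMap.rTensor_comp_lTensor,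
        LinearMap.lTensor_comp_rTensor]
    rw [this, ← hz, ← LinearMap.rTensor_comp_apply, hrρ, LinearMap.rTensor_id, LinearMap.id_apply]

end Cofree

theorem cotensor_left_exact_and_exact_iff_injective
    (k : Type) [Field k] (h2 : (2 : k) ≠ 0)
    (C : Type) [AddCommGroup C] [Module k C]
    (Δ : C →ₗ[k] C ⊗[k] C) (ε : C →ₗ[k] k) (hC : IsCoalg Δ ε)
    (𝒞 : ZMod 2 → Submodule k C) [DirectSum.Decomposition 𝒞]
    (hΔgr : ∀ n : ZMod 2, ∀ c ∈ 𝒞 n, gradedTensorMem 𝒞 𝒞 n (Δ c))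
    (hεgr : ∀ c ∈ 𝒞 1, ε c = 0)
    -- `V` a right `C`-supercomodule
    (V : Type) [AddCommGroup V] [Module k V]
    (𝒱 : ZMod 2 → Submodule k V) [DirectSum.Decomposition 𝒱]
    (ρ : V →ₗ[k] V ⊗[k] C) (hV : IsRightComod Δ ε ρ) (hVgr : RightComodGraded 𝒞 𝒱 ρ) :
    -- (1) `V □_C −` is left exact: it preserves kernels of maps of left supercomodules
    (∀ (W' W : Type) (_ : AddCommGroup W') (_ : Module k W')
      (_ : AddCommGroup W) (_ : Module k W)
      (𝒲' : ZMod 2 → Submodule k W') (𝒲 : ZMod 2 → Submodule k W)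
      (_ : DirectSum.Decomposition 𝒲') (_ : DirectSum.Decomposition 𝒲)
      (lam' : W' →ₗ[k] C ⊗[k] W') (lam : W →ₗ[k] C ⊗[k] W),
      IsLeftComod Δ ε lam' → IsLeftComod Δ ε lam →
      LeftComodGraded 𝒞 𝒲' lam' → LeftComodGraded 𝒞 𝒲 lam →
      ∀ (f : W' →ₗ[k] W),
        ((LinearMap.lTensor C f) ∘ₗ lam' = lam ∘ₗ f) →
        (∀ i : ZMod 2, ∀ w ∈ 𝒲' i, f w ∈ 𝒲 i) →
        Function.Injective f →
        -- `V □ f` is injective and its image is the preimage of `V □ W'` in `V □ W`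
        ((∀ z ∈ cotensor ρ lam', LinearMap.lTensor V f z = 0 → z = 0) ∧
          ∀ (W'' : Type) (_ : AddCommGroup W'') (_ : Module k W'')
            (𝒲'' : ZMod 2 → Submodule k W'') (_ : DirectSum.Decomposition 𝒲'')
            (lam'' : W'' →ₗ[k] C ⊗[k] W''),
            IsLeftComod Δ ε lam'' → LeftComodGraded 𝒞 𝒲'' lam'' →
            ∀ (g : W →ₗ[k] W''),
              ((LinearMap.lTensor C g) ∘ₗ lam = lam'' ∘ₗ g) →
              (∀ i : ZMod 2, ∀ w ∈ 𝒲 i, g w ∈ 𝒲'' i) →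
              LinearMap.ker g = LinearMap.range f →
              ∀ z ∈ cotensor ρ lam, LinearMap.lTensor V g z = 0 →
                ∃ z' ∈ cotensor ρ lam', LinearMap.lTensor V f z' = z))
    ∧
    -- (2) `V □_C −` is exact (i.e. moreover preserves surjections of left
    -- supercomodules) if and only if `V` is injective as a right `C`-supercomodule
    ((∀ (W W'' : Type) (_ : AddCommGroup W) (_ : Module k W)
      (_ : AddCommGroup W'') (_ : Module k W'')
      (𝒲 : ZMod 2 → Submodule k W) (𝒲'' : ZMod 2 → Submodule k W'')
      (_ : DirectSum.Decomposition 𝒲) (_ : DirectSum.Decomposition 𝒲'')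
      (lam : W →ₗ[k] C ⊗[k] W) (lam'' : W'' →ₗ[k] C ⊗[k] W''),
      IsLeftComod Δ ε lam → IsLeftComod Δ ε lam'' →
      LeftComodGraded 𝒞 𝒲 lam → LeftComodGraded 𝒞 𝒲'' lam'' →
      ∀ (g : W →ₗ[k] W''),
        ((LinearMap.lTensor C g) ∘ₗ lam = lam'' ∘ₗ g) →
        (∀ i : ZMod 2, ∀ w ∈ 𝒲 i, g w ∈ 𝒲'' i) →
        Function.Surjective g →
        ∀ z'' ∈ cotensor ρ lam'', ∃ z ∈ cotensor ρ lam,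
          LinearMap.lTensor V g z = z'')
      ↔
      -- `V` is injective in right `C`-supercomodules
      (∀ (U U' : Type) (_ : AddCommGroup U) (_ : Module k U)
        (_ : AddCommGroup U') (_ : Module k U')
        (𝒰 : ZMod 2 → Submodule k U) (𝒰' : ZMod 2 → Submodule k U')
        (_ : DirectSum.Decomposition 𝒰) (_ : DirectSum.Decomposition 𝒰')
        (ρU : U →ₗ[k] U ⊗[k] C) (ρU' : U' →ₗ[k] U' ⊗[k] C),
        IsRightComod Δ ε ρU → IsRightComod Δ ε ρU' →
        RightComodGraded 𝒞 𝒰 ρU → RightComodGraded 𝒞 𝒰' ρU' →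
        ∀ (ι : U →ₗ[k] U'),
          ((LinearMap.rTensor C ι) ∘ₗ ρU = ρU' ∘ₗ ι) →
          (∀ i : ZMod 2, ∀ u ∈ 𝒰 i, ι u ∈ 𝒰' i) →
          Function.Injective ι →
          ∀ (h : U →ₗ[k] V),
            ((LinearMap.rTensor C h) ∘ₗ ρU = ρ ∘ₗ h) →
            (∀ i : ZMod 2, ∀ u ∈ 𝒰 i, h u ∈ 𝒱 i) →
            ∃ h' : U' →ₗ[k] V,
              ((LinearMap.rTensor C h') ∘ₗ ρU' = ρ ∘ₗ h') ∧
              (∀ i : ZMod 2, ∀ u ∈ 𝒰' i, h' u ∈ 𝒱 i) ∧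
              h' ∘ₗ ι = h)) := by
  obtain ⟨σC, hσC⟩ := exists_parity h2 𝒞 inferInstance
  obtain ⟨σV, hσV⟩ := exists_parity h2 𝒱 inferInstance
  have hΔ : ∀ c, Δ (σC c) = TensorProduct.map σC σC (Δ c) :=
    (even_iff h2 hσC (hσC.tensor_even h2 hσC) (hσC.tensor_odd h2 hσC) Δ).1 hΔgr
  have hρV : ∀ c, ρ (σV c) = TensorProduct.map σV σC (ρ c) :=
    (even_iff h2 hσV (hσV.tensor_even h2 hσC) (hσV.tensor_odd h2 hσC) ρ).1 hVgr
  refine ⟨?_, ?_, ?_⟩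
  · intro W' W _ _ _ _ 𝒲' 𝒲 _ _ lam' lam hlam' hlam _ _ f hf _ hinj
    refine ⟨fun z _ hz => lTensor_inj V hinj (by rw [hz, map_zero]), ?_⟩
    intro W'' _ _ 𝒲'' _ lam'' _ _ g hg _ hker z hz hgz
    have hex : Function.Exact (LinearMap.lTensor V f) (LinearMap.lTensor V g) :=
      Module.Flat.lTensor_exact V (LinearMap.exact_iff.2 hker)
    obtain ⟨z', rfl⟩ := (hex z).1 hgz
    refine ⟨z', ?_, rfl⟩
    rw [mem_cotensor, cotensor_nat ρ hf] at hz
    rw [mem_cotensor]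
    apply lTensor_inj (V ⊗[k] C) hinj
    rw [← hz, ← LinearMap.comp_apply, ← LinearMap.comp_apply, LinearMap.rTensor_comp_lTensor,
        LinearMap.lTensor_comp_rTensor]
  · intro H U U' _ _ _ _ 𝒰 𝒰' _ _ ρU ρU' hU hU' hUgr hU'gr ι hι hιgr hιinj h hh hhgr
    obtain ⟨σU, hσU⟩ := exists_parity h2 𝒰 inferInstance
    obtain ⟨σ, hσ⟩ := exists_parity h2 𝒰' inferInstance
    have hρU' : ∀ c, ρU' (σ c) = TensorProduct.map σ σC (ρU' c) :=
      (even_iff h2 hσ (hσ.tensor_even h2 hσC) (hσ.tensor_odd h2 hσC) ρU').1 hU'gr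
    have hισ : ∀ u, ι (σU u) = σ (ι u) :=
      (even_iff h2 hσU (P := fun i w => w ∈ 𝒰' i) hσ.even hσ.odd ι).1 hιgr
    have hhσ : ∀ u, h (σU u) = σV (h u) :=
      (even_iff h2 hσU (P := fun i w => w ∈ 𝒱 i) hσV.even hσV.odd h).1 hhgr
    rw [comodHom_iff] at hι hh
    let e := LinearEquiv.ofInjective ι hιinj
    have he : ∀ u (hu : ι u ∈ LinearMap.range ι), e.symm ⟨ι u, hu⟩ = u := by
      intro u hu
      rw [LinearEquiv.symm_apply_eq]
      rfl
    let f0 : U' →ₗ.[k] V := ⟨LinearMap.range ι, h ∘ₗ e.symm.toLinearMap⟩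
    have hf0 : PComod ρU' σ ρ f0 := by
      refine ⟨⟨?_, ?_⟩, ?_⟩
      · rintro φ _ ⟨u, rfl⟩
        exact ⟨_, hι φ u⟩
      · rintro _ ⟨u, rfl⟩
        exact ⟨_, hισ u⟩
      · rintro φ ⟨_, ⟨u, rfl⟩⟩ ⟨u', hu'⟩ huu
        have huu' : u' = act ρU' φ (ι u) := huu
        rw [← hι] at huu'
        subst huu'
        exact (congrArg h (he _ _)).trans ((hh φ u).trans
          (congrArg (fun x => act ρ φ (h x)) (he u ⟨u, rfl⟩).symm))
    obtain ⟨g, hg, hgf⟩ := zorn_extend hU' hσ.inv hρU' ρ (by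
      intro S T hTfg hS hT hST f hf
      have : Module.Finite k T := Module.Finite.iff_fg.2 hTfg
      have : Module.Finite k S := Submodule.finiteDimensional_of_le hST
      obtain ⟨ρS, hρS, hcS⟩ := exists_restrict hU' hS.act
      obtain ⟨ρT, hρT, hcT⟩ := exists_restrict hU' hT.act
      have hcS0 := hcS
      have hcT0 := hcT
      rw [comodHom_iff] at hcS hcT
      let σS : S →ₗ[k] S := σ.restrict hS.par
      let σT : T →ₗ[k] T := σ.restrict hT.par
      have hpar : ∀ (R : Submodule k U') (hR : Stable ρU' σ R) (ρR : R →ₗ[k] R ⊗[k] C),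
          (LinearMap.rTensor C R.subtype ∘ₗ ρR = ρU' ∘ₗ R.subtype) →
          ∀ u, ρR ((σ.restrict hR.par) u) = TensorProduct.map (σ.restrict hR.par) σC (ρR u) := by
        intro R hR ρR hcR u
        apply rTensor_inj C R.injective_subtype
        have e1 := LinearMap.congr_fun hcR ((σ.restrict hR.par) u)
        have e2 := LinearMap.congr_fun hcR u
        simp only [LinearMap.comp_apply] at e1 e2
        rw [e1]
        have e3 : ∀ z : R ⊗[k] C, LinearMap.rTensor C R.subtype
            (TensorProduct.map (σ.restrict hR.par) σC z) =
            TensorProduct.map σ σC (LinearMap.rTensor C R.subtype z) := by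
          intro z
          induction z with
          | zero => simp
          | tmul a b => simp
          | add a b ha hb => simp only [map_add, ha, hb]
        rw [e3, e2]
        exact hρU' u
      have hpS := dualCo_parity hσC.inv (hpar S hS ρS hcS0)
      have hpT := dualCo_parity hσC.inv (hpar T hT ρT hcT0)
      have hinv : ∀ (R : Submodule k U') (hR : Stable ρU' σ R) (φ : Module.Dual k R),
          (σ.restrict hR.par).dualMap ((σ.restrict hR.par).dualMap φ) = φ := by
        intro R hR φ
        ext x
        show φ _ = φ x
        congr 1
        exact Subtype.ext (hσ.inv x)
      obtain ⟨𝒮, D1, hσS⟩ := exists_grading h2 _ (hinv S hS)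
      obtain ⟨𝒯, D2, hσT⟩ := exists_grading h2 _ (hinv T hT)
      let i : S →ₗ[k] T := Submodule.inclusion hST
      have hi : LinearMap.rTensor C i ∘ₗ ρS = ρT ∘ₗ i := by
        rw [comodHom_iff]
        intro φ s
        apply Subtype.ext
        exact (hcS φ s).trans (hcT φ (i s)).symm
      have hfc : LinearMap.rTensor C f ∘ₗ ρS = ρ ∘ₗ f := by
        rw [comodHom_iff]
        intro φ s
        exact hf.hom φ s _ (hcS φ s)
      obtain ⟨t, ht, hti⟩ := H (Module.Dual k T) (Module.Dual k S) _ _ _ _ 𝒯 𝒮 D2 D1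
        (dualCo ρT) (dualCo ρS) (dualCo_comod hρT) (dualCo_comod hρS)
        ((even_iff h2 hσT (hσC.tensor_even h2 hσT) (hσC.tensor_odd h2 hσT) _).2 hpT)
        ((even_iff h2 hσS (hσC.tensor_even h2 hσS) (hσC.tensor_odd h2 hσS) _).2 hpS)
        i.dualMap (dualCo_hom hi)
        ((even_iff h2 hσT (P := fun i w => w ∈ 𝒮 i) hσS.even hσS.odd _).2 (by
          intro φ
          ext x
          rfl))
        (LinearMap.dualMap_surjective_of_injective (Submodule.inclusion_injective hST))
        ((evE V S).symm f) (by
          rw [mem_cotensor_dual, LinearEquiv.apply_symm_apply]; exact hfc)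
      rw [mem_cotensor_dual, comodHom_iff] at ht
      refine ⟨evE V T t, ⟨hT, ?_⟩, ?_⟩
      · intro φ u u' huu
        have : u' = act ρT φ u := Subtype.ext (huu.trans (hcT φ u).symm)
        subst this
        exact ht φ u
      · intro s
        have := congrArg (evE V S) hti
        rw [evE_lTensor, LinearEquiv.apply_symm_apply] at this
        exact LinearMap.congr_fun this s) f0 hf0
    have hgι : ∀ u, g (ι u) = h u := by
      intro u
      exact (hgf ⟨ι u, ⟨u, rfl⟩⟩).trans (congrArg h (he u ⟨u, rfl⟩))
    refine ⟨(2 : k)⁻¹ • (g + σV ∘ₗ g ∘ₗ σ), ?_, ?_, ?_⟩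
    · rw [comodHom_iff]
      intro φ u
      have e1 : σV (g (σ (act ρU' φ u))) = act ρ φ (σV (g (σ u))) := by
        have a1 := act_parity hρV φ (g (σ u))
        have a2 := act_parity hρU' (φ ∘ₗ σC) u
        have a3 : (φ ∘ₗ σC) ∘ₗ σC = φ := by ext c; simp [hσC.inv]
        rw [a3] at a2
        rw [a1, ← hg, a2]
      simp only [LinearMap.smul_apply, LinearMap.add_apply, LinearMap.comp_apply, map_smul,
        map_add, hg, e1]
    · refine (even_iff h2 hσ (P := fun i w => w ∈ 𝒱 i) hσV.even hσV.odd _).2 ?_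
      intro u
      simp only [LinearMap.smul_apply, LinearMap.add_apply, LinearMap.comp_apply, map_smul,
        map_add, hσ.inv, hσV.inv]
      rw [add_comm]
    · ext u
      simp only [LinearMap.smul_apply, LinearMap.add_apply, LinearMap.comp_apply]
      rw [← hισ, hgι, hgι, hhσ, hσV.inv, half_add_half h2]
  · intro H W W'' _ _ _ _ 𝒲 𝒲'' _ _ lam lam'' hlam _ _ _ g hg _ hs z'' hz
    obtain ⟨𝒯, D, hσT⟩ := exists_grading h2 (TensorProduct.map σV σC)
      (map_map_inv hσV.inv hσC.inv)
    obtain ⟨r, hr, -, hrρ⟩ := H V (V ⊗[k] C) _ _ _ _ 𝒱 𝒯 inferInstance D ρ (cofree V Δ) hV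
      (cofree_comod hC) hVgr
      ((even_iff h2 hσT (hσT.tensor_even h2 hσC) (hσT.tensor_odd h2 hσC) _).2 (cofree_parity hΔ))
      ρ (by
        ext v
        apply (TensorProduct.assoc k V C C).injective
        have := LinearMap.congr_fun hV.1 v
        simpa [cofree] using this)
      ((even_iff h2 hσV (P := fun i w => w ∈ 𝒯 i) hσT.even hσT.odd _).2 hρV)
      (Function.LeftInverse.injective (g := ctr V ε) (act_counit hV))
      LinearMap.id (by ext v; simp) (fun _ _ hu => hu)
    exact exact_of_retract hr hrρ hlam hg hs z'' hz
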